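/- arXiv:1701.05965 — 2 statements merged into one kernel-verified Lean document; each statement's English description precedes it below -/
import Mathlib

section
/- Let m ≥ 4 be even and let e = m/2. Then the supports of the codewords of C̄_e^⊥ of a fixed weight k form the blocks of a 2-(2^m, k, λ) design on the point set F for each of the following pairs: (i) k = 2^{m−1}−2^{(m−2)/2} with λ = 2^{(m−2)/2}(2^{m/2}−1)(2^{(m−2)/2}−1); (ii) k = 2^{m−1}+2^{(m−2)/2} with λ = 2^{(m−2)/2}(2^{m/2}−1)(2^{(m−2)/2}+1); (iii) k = 2^{m−1} with λ = 2^{m−1}−1. That is, for each such (k,λ), every 2-element subset of F is contained in the supports of exactly λ codewords of C̄_e^⊥ of weight k. -/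
noncomputable local instance (m : ℕ) : Fintype (GaloisField 2 m) := Fintype.ofFinite _
attribute [local instance] Classical.propDecidable

/-- `∑_{g∈F} ι(c(g))·g^s ∈ F = GF(2^m)`, where `ι : 𝔽₂ → F` is the unique ring hom. -/
noncomputable def phiF (m s : ℕ) :
    (GaloisField 2 m → ZMod 2) →ₗ[ZMod 2] GaloisField 2 m where
  toFun c := ∑ g, algebraMap (ZMod 2) (GaloisField 2 m) (c g) * g ^ s
  map_add' c d := by simp [add_mul, Finset.sum_add_distrib]
  map_smul' a c := by simp [Algebra.smul_def, mul_assoc, Finset.mul_sum]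

/-- The parity functional `c ↦ ∑_{g∈F} c(g) ∈ 𝔽₂`. -/
noncomputable def parF (m : ℕ) : (GaloisField 2 m → ZMod 2) →ₗ[ZMod 2] ZMod 2 where
  toFun c := ∑ g, c g
  map_add' c d := by simp [Finset.sum_add_distrib]
  map_smul' a c := by simp [Finset.mul_sum]

/-- The extended binary cyclic code `C̄_e` of length `2^m`, with coordinates indexed by
`F = GF(2^m)`: all `c : F → 𝔽₂` with `∑_{g∈F} c(g) = 0` in `𝔽₂`,
`∑_{g∈F} ι(c(g))·g = 0` and `∑_{g∈F} ι(c(g))·g^{2^e+1} = 0` in `F`. -/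
noncomputable def extCode (m e : ℕ) : Submodule (ZMod 2) (GaloisField 2 m → ZMod 2) :=
  LinearMap.ker (parF m) ⊓ LinearMap.ker (phiF m 1) ⊓ LinearMap.ker (phiF m (2 ^ e + 1))

/-- The dual code `C̄_e^⊥`. -/
noncomputable def dualCode (m e : ℕ) : Submodule (ZMod 2) (GaloisField 2 m → ZMod 2) where
  carrier := {y | ∀ c ∈ extCode m e, ∑ g, c g * y g = 0}
  add_mem' := by
    intro a b ha hb c hc
    simp only [Pi.add_apply, mul_add, Finset.sum_add_distrib, ha c hc, hb c hc, add_zero]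
  zero_mem' := by intro c hc; simp
  smul_mem' := by
    intro a y hy c hc
    simp only [Pi.smul_apply, smul_eq_mul, mul_left_comm, ← Finset.mul_sum, hy c hc, mul_zero]

/-- The Hamming weight of a codeword. -/
noncomputable def wt {m : ℕ} (y : GaloisField 2 m → ZMod 2) : ℕ :=
  (Finset.univ.filter fun g => y g ≠ 0).card

/-- The sign character `a ↦ (-1)^a` of `𝔽₂`, with integer values. -/
def sgn (a : ZMod 2) : ℤ := if a = 0 then 1 else -1

theorem sgn_add (a b : ZMod 2) : sgn (a + b) = sgn a * sgn b := by
  revert a b; decide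

theorem sgn_mul_self (a : ZMod 2) : sgn a * sgn a = 1 := by
  revert a; decide

theorem two_mul_ite_ne_zero (a : ZMod 2) : (2 : ℤ) * (if a ≠ 0 then 1 else 0) = 1 - sgn a := by
  by_cases h : a = 0 <;> simp [sgn, h]

theorem four_mul_ite_ne_zero_and (a b : ZMod 2) :
    (4 : ℤ) * (if a ≠ 0 ∧ b ≠ 0 then 1 else 0) = (1 - sgn a) * (1 - sgn b) := by
  by_cases h : a = 0 <;> by_cases h' : b = 0 <;> simp [sgn, h, h']

theorem sum_sgn_eq_zero {V : Type*} [AddCommGroup V] [Module (ZMod 2) V] [Fintype V]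
    {f : V →ₗ[ZMod 2] ZMod 2} (hf : f ≠ 0) : ∑ v, sgn (f v) = 0 := by
  obtain ⟨w, hw⟩ : ∃ w, f w ≠ 0 := by
    by_contra! h
    exact hf (LinearMap.ext h)
  have h := Equiv.sum_comp (Equiv.addRight w) fun v => sgn (f v)
  have hs : sgn (f w) = -1 := by simp [sgn, hw]
  simp only [Equiv.coe_addRight, map_add, sgn_add, hs, mul_neg, mul_one,
    Finset.sum_neg_distrib] at h
  linarith

noncomputable local instance {V : Type*} [AddCommGroup V] [Module (ZMod 2) V] [Finite V] :
    Fintype (Module.Dual (ZMod 2) V) :=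
  have : Finite (Module.Dual (ZMod 2) V) := DFunLike.finite _
  Fintype.ofFinite _

noncomputable local instance {V : Type*} [AddCommGroup V] [Module (ZMod 2) V] :
    DecidableEq (Module.Dual (ZMod 2) V) := Classical.decEq _

theorem card_dual_zmod_two (V : Type*) [AddCommGroup V] [Module (ZMod 2) V] [Fintype V] :
    Fintype.card (Module.Dual (ZMod 2) V) = Fintype.card V := by
  have : Module.Finite (ZMod 2) V := Module.Finite.of_finite
  rw [Module.card_eq_pow_finrank (K := ZMod 2), Module.card_eq_pow_finrank (K := ZMod 2) (V := V),
    Subspace.dual_finrank_eq]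

theorem sum_sgn_dual_eq_zero {V : Type*} [AddCommGroup V] [Module (ZMod 2) V] [Fintype V]
    {v : V} (hv : v ≠ 0) : ∑ φ : Module.Dual (ZMod 2) V, sgn (φ v) = 0 :=
  sum_sgn_eq_zero (f := Module.Dual.eval (ZMod 2) V v) fun h =>
    hv <| (Module.forall_dual_apply_eq_zero_iff (ZMod 2) v).1 fun φ => LinearMap.congr_fun h φ

theorem card_ker_mul_card_range {V W : Type*} [AddCommGroup V] [Module (ZMod 2) V]
    [AddCommGroup W] [Module (ZMod 2) W] [Finite V] (f : V →ₗ[ZMod 2] W) :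
    Nat.card (LinearMap.ker f) * Nat.card (LinearMap.range f) = Nat.card V := by
  rw [← Nat.card_congr f.quotKerEquivRange.toEquiv]
  exact ((LinearMap.ker f).card_eq_card_quotient_mul_card).symm

theorem frob_frob_of_card {F : Type*} [Field F] [Fintype F] {e : ℕ}
    (hF : Fintype.card F = (2 ^ e) ^ 2) (g : F) :
    (g ^ 2 ^ e) ^ 2 ^ e = g := by
  rw [← pow_mul, ← sq, ← hF, FiniteField.pow_card]

section RelativeNorm

variable {F : Type*} [Field F] [CharP F 2] [Algebra (ZMod 2) F] {e : ℕ}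

/-- The additive map `v ↦ v^(2^e) + v`. -/
noncomputable def frobAddId (F : Type*) [Field F] [CharP F 2] [Algebra (ZMod 2) F] (e : ℕ) :
    F →ₗ[ZMod 2] F :=
  AddMonoidHom.toZModLinearMap 2
    { toFun := fun v => v ^ 2 ^ e + v
      map_zero' := by simp
      map_add' := fun a b => by rw [add_pow_char_pow]; ring }

theorem frobAddId_apply (v : F) : frobAddId F e v = v ^ 2 ^ e + v := rfl

/-- The fixed points of `v ↦ v^(2^e)`, as an `𝔽₂`-subspace. -/
noncomputable def frobFixed (F : Type*) [Field F] [CharP F 2] [Algebra (ZMod 2) F] (e : ℕ) :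
    Submodule (ZMod 2) F := LinearMap.ker (frobAddId F e)

theorem mem_frobFixed {v : F} : v ∈ frobFixed F e ↔ v ^ 2 ^ e = v := by
  rw [frobFixed, LinearMap.mem_ker, frobAddId_apply, CharTwo.add_eq_zero]

/-- The relative trace `v ↦ v^(2^e) + v` onto the fixed points. -/
noncomputable def relTrace (h : ∀ g : F, (g ^ 2 ^ e) ^ 2 ^ e = g) :
    F →ₗ[ZMod 2] frobFixed F e :=
  (frobAddId F e).codRestrict _ fun v => by
    rw [mem_frobFixed, frobAddId_apply, add_pow_char_pow, h, add_comm]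

/-- The relative norm `v ↦ v^(2^e+1)` to the fixed points. -/
noncomputable def relNorm (h : ∀ g : F, (g ^ 2 ^ e) ^ 2 ^ e = g) (v : F) : frobFixed F e :=
  ⟨v ^ (2 ^ e + 1), by rw [mem_frobFixed, pow_succ, mul_pow, h, mul_comm]⟩

theorem relNorm_zero (h : ∀ g : F, (g ^ 2 ^ e) ^ 2 ^ e = g) : relNorm h 0 = 0 :=
  Subtype.ext (by simp [relNorm])

theorem relNorm_ne_zero (h : ∀ g : F, (g ^ 2 ^ e) ^ 2 ^ e = g) {v : F} (hv : v ≠ 0) :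
    relNorm h v ≠ 0 := fun h0 => hv <| by
  simpa [relNorm] using congrArg Subtype.val h0

theorem relNorm_add (h : ∀ g : F, (g ^ 2 ^ e) ^ 2 ^ e = g) (g u : F) :
    relNorm h (g + u) = relNorm h g + relTrace h (u ^ 2 ^ e * g) + relNorm h u := by
  apply Subtype.ext
  change (g + u) ^ (2 ^ e + 1) =
    g ^ (2 ^ e + 1) + ((u ^ 2 ^ e * g) ^ 2 ^ e + u ^ 2 ^ e * g) + u ^ (2 ^ e + 1)
  rw [pow_succ, add_pow_char_pow, mul_pow, h]
  ring

theorem natCard_frobFixed_le (he : e ≠ 0) : Nat.card (frobFixed F e) ≤ 2 ^ e := by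
  classical
  have hq : 1 < 2 ^ e := Nat.one_lt_two_pow he
  have hsub : (frobFixed F e : Set F) ⊆
      ((Polynomial.X ^ 2 ^ e - Polynomial.X : Polynomial F).roots.toFinset : Set F) := by
    intro v hv
    simp [FiniteField.X_pow_card_sub_X_ne_zero F hq, mem_frobFixed.1 hv]
  calc Nat.card (frobFixed F e) = (frobFixed F e : Set F).ncard := rfl
    _ ≤ _ := Set.ncard_le_ncard hsub (Finset.finite_toSet _)
    _ ≤ _ := by rw [Set.ncard_coe_finset]
    _ ≤ _ := Multiset.toFinset_card_le _
    _ ≤ _ := Polynomial.card_roots' _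
    _ = _ := FiniteField.X_pow_card_sub_X_natDegree_eq F hq

/-- The functional `g ↦ φ(Tr(u^(2^e) g))`. -/
noncomputable def traceForm (h : ∀ g : F, (g ^ 2 ^ e) ^ 2 ^ e = g)
    (φ : Module.Dual (ZMod 2) (frobFixed F e)) (u : F) : Module.Dual (ZMod 2) F :=
  φ ∘ₗ relTrace h ∘ₗ LinearMap.mulLeft (ZMod 2) (u ^ 2 ^ e)

theorem traceForm_apply (h : ∀ g : F, (g ^ 2 ^ e) ^ 2 ^ e = g)
    (φ : Module.Dual (ZMod 2) (frobFixed F e)) (u g : F) :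
    traceForm h φ u g = φ (relTrace h (u ^ 2 ^ e * g)) := rfl

theorem traceForm_add (h : ∀ g : F, (g ^ 2 ^ e) ^ 2 ^ e = g)
    (φ : Module.Dual (ZMod 2) (frobFixed F e)) (u v : F) :
    traceForm h φ (u + v) = traceForm h φ u + traceForm h φ v := by
  ext g
  simp [traceForm_apply, add_pow_char_pow, add_mul]

theorem dual_relNorm_add (h : ∀ g : F, (g ^ 2 ^ e) ^ 2 ^ e = g)
    (φ : Module.Dual (ZMod 2) (frobFixed F e)) (g u : F) :
    φ (relNorm h (g + u)) = φ (relNorm h g) + traceForm h φ u g + φ (relNorm h u) := by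
  simp [relNorm_add, traceForm_apply]

variable [Fintype F]

theorem natCard_frobFixed_and_surjective (he : e ≠ 0) (hF : Fintype.card F = (2 ^ e) ^ 2)
    (h : ∀ g : F, (g ^ 2 ^ e) ^ 2 ^ e = g) :
    Nat.card (frobFixed F e) = 2 ^ e ∧ Function.Surjective (relTrace h) := by
  have hker : LinearMap.ker (relTrace h) = frobFixed F e := LinearMap.ker_codRestrict _ _ _
  have hmul := card_ker_mul_card_range (relTrace h)
  rw [hker, Nat.card_eq_fintype_card (α := F), hF] at hmul
  have hle := natCard_frobFixed_le (F := F) he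
  have hr : Nat.card (LinearMap.range (relTrace h)) ≤ Nat.card (frobFixed F e) :=
    Nat.card_le_card_of_injective _ Subtype.val_injective
  have hpos : 0 < 2 ^ e := by positivity
  have hK : Nat.card (frobFixed F e) = 2 ^ e := by nlinarith
  refine ⟨hK, ?_⟩
  have hr' : Nat.card (LinearMap.range (relTrace h)) = 2 ^ e := by
    rw [hK] at hmul
    nlinarith
  rw [← LinearMap.range_eq_top]
  apply SetLike.coe_injective
  rw [Submodule.top_coe]
  apply Set.eq_of_subset_of_ncard_le (Set.subset_univ _)
  rw [Set.ncard_univ, hK, ← hr']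
  rfl

noncomputable local instance : Fintype (frobFixed F e) := Fintype.ofFinite _

theorem traceForm_ne_zero (he : e ≠ 0) (hF : Fintype.card F = (2 ^ e) ^ 2)
    (h : ∀ g : F, (g ^ 2 ^ e) ^ 2 ^ e = g)
    {φ : Module.Dual (ZMod 2) (frobFixed F e)} (hφ : φ ≠ 0) {u : F} (hu : u ≠ 0) :
    traceForm h φ u ≠ 0 := by
  intro h0
  apply hφ
  ext k
  obtain ⟨v, rfl⟩ := (natCard_frobFixed_and_surjective he hF h).2 k
  have := LinearMap.congr_fun h0 ((u ^ 2 ^ e)⁻¹ * v)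
  rwa [traceForm_apply, mul_inv_cancel_left₀ (pow_ne_zero _ hu)] at this

theorem traceForm_bijective (he : e ≠ 0) (hF : Fintype.card F = (2 ^ e) ^ 2)
    (h : ∀ g : F, (g ^ 2 ^ e) ^ 2 ^ e = g)
    {φ : Module.Dual (ZMod 2) (frobFixed F e)} (hφ : φ ≠ 0) :
    Function.Bijective (traceForm h φ) := by
  rw [Fintype.bijective_iff_injective_and_card, card_dual_zmod_two]
  refine ⟨fun u v huv => ?_, rfl⟩
  by_contra hne
  apply traceForm_ne_zero he hF h hφ (u := u + v) (by rwa [Ne, CharTwo.add_eq_zero])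
  rw [traceForm_add, huv]
  ext g
  exact CharTwo.add_self_eq_zero _

theorem sum_sgn_relNorm_mul (he : e ≠ 0) (hF : Fintype.card F = (2 ^ e) ^ 2)
    (h : ∀ g : F, (g ^ 2 ^ e) ^ 2 ^ e = g)
    {φ : Module.Dual (ZMod 2) (frobFixed F e)} (hφ : φ ≠ 0) {x y : F} (hxy : x ≠ y) :
    ∑ u, sgn (φ (relNorm h (u + x))) * sgn (φ (relNorm h (u + y))) = 0 := by
  have key : ∀ u, sgn (φ (relNorm h (u + x))) * sgn (φ (relNorm h (u + y))) =
      sgn (φ (relNorm h x) + φ (relNorm h y)) * sgn (traceForm h φ (x + y) u) := by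
    intro u
    rw [← sgn_add, ← sgn_add, dual_relNorm_add, dual_relNorm_add, traceForm_add,
      LinearMap.add_apply]
    congr 1
    linear_combination CharTwo.add_self_eq_zero (φ (relNorm h u))
  rw [Finset.sum_congr rfl fun u _ => key u, ← Finset.mul_sum,
    sum_sgn_eq_zero (traceForm_ne_zero he hF h hφ (by rwa [Ne, CharTwo.add_eq_zero])), mul_zero]

theorem sum_sgn_relNorm_sq (he : e ≠ 0) (hF : Fintype.card F = (2 ^ e) ^ 2)
    (h : ∀ g : F, (g ^ 2 ^ e) ^ 2 ^ e = g)
    {φ : Module.Dual (ZMod 2) (frobFixed F e)} (hφ : φ ≠ 0) :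
    (∑ g, sgn (φ (relNorm h g))) ^ 2 = (2 ^ e : ℤ) ^ 2 := by
  have hshift : ∀ g, ∑ d, sgn (φ (relNorm h (g + d))) = ∑ d, sgn (φ (relNorm h d)) := fun g =>
    Equiv.sum_comp (Equiv.addLeft g) fun d => sgn (φ (relNorm h d))
  calc (∑ g, sgn (φ (relNorm h g))) ^ 2
      = ∑ g, ∑ d, sgn (φ (relNorm h (g + 0))) * sgn (φ (relNorm h (g + d))) := by
        simp_rw [← Finset.mul_sum, hshift, ← Finset.sum_mul, add_zero, sq]
    _ = ∑ d, ∑ g, sgn (φ (relNorm h (g + 0))) * sgn (φ (relNorm h (g + d))) :=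
        Finset.sum_comm
    _ = ∑ g, sgn (φ (relNorm h (g + 0))) * sgn (φ (relNorm h (g + 0))) :=
        Fintype.sum_eq_single 0 fun d hd => sum_sgn_relNorm_mul he hF h hφ hd.symm
    _ = (2 ^ e : ℤ) ^ 2 := by
        simp [sgn_mul_self, hF]

theorem sum_sgn_relNorm (he : e ≠ 0) (hF : Fintype.card F = (2 ^ e) ^ 2)
    (h : ∀ g : F, (g ^ 2 ^ e) ^ 2 ^ e = g)
    {φ : Module.Dual (ZMod 2) (frobFixed F e)} (hφ : φ ≠ 0) :
    ∑ g, sgn (φ (relNorm h g)) = -2 ^ e := by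
  have hcard : Fintype.card (Module.Dual (ZMod 2) (frobFixed F e)) = 2 ^ e := by
    rw [card_dual_zmod_two, ← Nat.card_eq_fintype_card,
      (natCard_frobFixed_and_surjective he hF h).1]
  have htotal : ∑ φ : Module.Dual (ZMod 2) (frobFixed F e), ∑ g, sgn (φ (relNorm h g)) =
      2 ^ e := by
    rw [Finset.sum_comm, Fintype.sum_eq_single 0 fun g hg =>
      sum_sgn_dual_eq_zero (relNorm_ne_zero h hg)]
    simp [relNorm_zero, sgn, hcard]
  have hzero : ∑ g, sgn ((0 : Module.Dual (ZMod 2) (frobFixed F e)) (relNorm h g)) =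
      (2 ^ e) ^ 2 := by
    simp [sgn, hF]
  have hsum : ∑ φ ∈ Finset.univ.erase (0 : Module.Dual (ZMod 2) (frobFixed F e)),
      (∑ g, sgn (φ (relNorm h g)) + 2 ^ e) = 0 := by
    rw [Finset.sum_erase_eq_sub (Finset.mem_univ _), Finset.sum_add_distrib, htotal, hzero]
    simp [hcard]
    ring
  have hnonneg : ∀ ψ ∈ Finset.univ.erase (0 : Module.Dual (ZMod 2) (frobFixed F e)),
      0 ≤ ∑ g, sgn (ψ (relNorm h g)) + 2 ^ e := by
    intro ψ hψ
    have := sum_sgn_relNorm_sq he hF h (Finset.ne_of_mem_erase hψ)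
    have hpos : (0 : ℤ) < 2 ^ e := by positivity
    nlinarith [abs_le_of_sq_le_sq this.le hpos.le]
  have := (Finset.sum_eq_zero_iff_of_nonneg hnonneg).1 hsum φ
    (Finset.mem_erase.2 ⟨hφ, Finset.mem_univ _⟩)
  linarith

theorem sum_sgn_relNorm_add (he : e ≠ 0) (hF : Fintype.card F = (2 ^ e) ^ 2)
    (h : ∀ g : F, (g ^ 2 ^ e) ^ 2 ^ e = g)
    {φ : Module.Dual (ZMod 2) (frobFixed F e)} (hφ : φ ≠ 0) (u : F) :
    ∑ g, sgn (φ (relNorm h (g + u))) = -2 ^ e :=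
  (Equiv.sum_comp (Equiv.addRight u) fun g => sgn (φ (relNorm h g))).trans
    (sum_sgn_relNorm he hF h hφ)

/-- The word `g ↦ φ(N(g+u)) + b`. -/
noncomputable def normWord (h : ∀ g : F, (g ^ 2 ^ e) ^ 2 ^ e = g) (b : ZMod 2)
    (p : Module.Dual (ZMod 2) (frobFixed F e) × F) (g : F) : ZMod 2 :=
  p.1 (relNorm h (g + p.2)) + b

theorem normWord_injOn (he : e ≠ 0) (hF : Fintype.card F = (2 ^ e) ^ 2)
    (h : ∀ g : F, (g ^ 2 ^ e) ^ 2 ^ e = g) (b : ZMod 2) :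
    Set.InjOn (normWord h b) {p | p.1 ≠ 0} := by
  rintro ⟨φ, u⟩ hφ ⟨φ', u'⟩ - heq
  have hg : ∀ g, φ (relNorm h g) + traceForm h φ u g + φ (relNorm h u) =
      φ' (relNorm h g) + traceForm h φ' u' g + φ' (relNorm h u') := by
    intro g
    have := congrFun heq g
    simp only [normWord, add_left_inj] at this
    rwa [dual_relNorm_add, dual_relNorm_add] at this
  have h0 : φ (relNorm h u) = φ' (relNorm h u') := by
    simpa [relNorm_zero] using hg 0
  have hg' : ∀ g, φ (relNorm h g) + traceForm h φ u g =
      φ' (relNorm h g) + traceForm h φ' u' g := by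
    intro g
    have := hg g
    rwa [h0, add_left_inj] at this
  obtain rfl : φ = φ' := by
    ext k
    obtain ⟨v, rfl⟩ := (natCard_frobFixed_and_surjective he hF h).2 k
    have h1 := hg' 1
    have h2 := hg' v
    have h3 := hg' (v + 1)
    simp only [dual_relNorm_add, map_add] at h3
    have h4 : traceForm h φ 1 v = traceForm h φ' 1 v := by linear_combination h3 - h1 - h2
    simpa [traceForm_apply] using h4
  have : traceForm h φ u = traceForm h φ u' := LinearMap.ext fun g => by
    simpa using hg' g
  rw [(traceForm_bijective he hF h hφ).1 this]

theorem card_normWord_pair (he : e ≠ 0) (hF : Fintype.card F = (2 ^ e) ^ 2)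
    (h : ∀ g : F, (g ^ 2 ^ e) ^ 2 ^ e = g) (b : ZMod 2) {x y : F} (hxy : x ≠ y) :
    (4 : ℤ) * Nat.card {p : Module.Dual (ZMod 2) (frobFixed F e) × F //
      p.1 ≠ 0 ∧ normWord h b p x ≠ 0 ∧ normWord h b p y ≠ 0} =
      (2 ^ e - 1) * ((2 ^ e) ^ 2 + 2 * sgn b * 2 ^ e) := by
  have hcard : Fintype.card (Module.Dual (ZMod 2) (frobFixed F e)) = 2 ^ e := by
    rw [card_dual_zmod_two, ← Nat.card_eq_fintype_card,
      (natCard_frobFixed_and_surjective he hF h).1]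
  have hinner : ∀ φ ∈ Finset.univ.erase (0 : Module.Dual (ZMod 2) (frobFixed F e)),
      ∑ u, (4 : ℤ) * (if normWord h b (φ, u) x ≠ 0 ∧ normWord h b (φ, u) y ≠ 0 then 1 else 0) =
        (2 ^ e) ^ 2 + 2 * sgn b * 2 ^ e := by
    intro φ hφ
    have hφ' := Finset.ne_of_mem_erase hφ
    have key : ∀ u, (4 : ℤ) * (if normWord h b (φ, u) x ≠ 0 ∧ normWord h b (φ, u) y ≠ 0
        then 1 else 0) = 1 - sgn b * sgn (φ (relNorm h (u + x)))
          - sgn b * sgn (φ (relNorm h (u + y)))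
          + sgn (φ (relNorm h (u + x))) * sgn (φ (relNorm h (u + y))) := by
      intro u
      rw [four_mul_ite_ne_zero_and]
      simp only [normWord, sgn_add, add_comm x, add_comm y]
      linear_combination (sgn (φ (relNorm h (u + x))) * sgn (φ (relNorm h (u + y)))) *
        sgn_mul_self b
    rw [Finset.sum_congr rfl fun u _ => key u, Finset.sum_add_distrib, Finset.sum_sub_distrib,
      Finset.sum_sub_distrib, ← Finset.mul_sum, ← Finset.mul_sum,
      sum_sgn_relNorm_add he hF h hφ', sum_sgn_relNorm_add he hF h hφ',
      sum_sgn_relNorm_mul he hF h hφ' hxy]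
    simp [hF]
    ring
  calc (4 : ℤ) * Nat.card {p : Module.Dual (ZMod 2) (frobFixed F e) × F //
      p.1 ≠ 0 ∧ normWord h b p x ≠ 0 ∧ normWord h b p y ≠ 0}
      = ∑ φ ∈ Finset.univ.erase (0 : Module.Dual (ZMod 2) (frobFixed F e)), ∑ u, (4 : ℤ) *
        (if normWord h b (φ, u) x ≠ 0 ∧ normWord h b (φ, u) y ≠ 0 then 1 else 0) := by
        rw [Nat.card_eq_fintype_card, Fintype.card_subtype, Finset.card_filter, Nat.cast_sum,
          Finset.mul_sum, Fintype.sum_prod_type,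
          ← Finset.add_sum_erase _ _ (Finset.mem_univ (0 : Module.Dual (ZMod 2) (frobFixed F e)))]
        rw [Finset.sum_eq_zero (fun u _ => by simp), zero_add]
        refine Finset.sum_congr rfl fun φ hφ => Finset.sum_congr rfl fun u _ => ?_
        simp [Finset.ne_of_mem_erase hφ]
    _ = _ := by
        rw [Finset.sum_congr rfl hinner, Finset.sum_const, Finset.card_erase_of_mem
          (Finset.mem_univ _), Finset.card_univ, hcard, nsmul_eq_mul,
          Nat.cast_sub Nat.one_le_two_pow]
        simp

theorem card_dual_pair {x y : F} (hxy : x ≠ y) :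
    2 * Nat.card {ψ : Module.Dual (ZMod 2) F // ψ ≠ 0 ∧ ψ x = ψ y} + 2 = Fintype.card F := by
  have hz : ∑ ψ : Module.Dual (ZMod 2) F, (1 - (2 : ℤ) * (if ψ (x + y) ≠ 0 then 1 else 0)) = 0 := by
    simp_rw [two_mul_ite_ne_zero, sub_sub_cancel]
    exact sum_sgn_dual_eq_zero (by rwa [Ne, CharTwo.add_eq_zero])
  have hcount : (Nat.card {ψ : Module.Dual (ZMod 2) F // ψ ≠ 0 ∧ ψ x = ψ y} : ℤ) + 1 =
      ∑ ψ : Module.Dual (ZMod 2) F, (1 - (if ψ (x + y) ≠ 0 then 1 else 0)) := by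
    rw [Nat.card_eq_fintype_card, Fintype.card_subtype, Finset.card_filter, Nat.cast_sum,
      ← Finset.add_sum_erase _ _ (Finset.mem_univ (0 : Module.Dual (ZMod 2) F)),
      ← Finset.add_sum_erase _ _ (Finset.mem_univ (0 : Module.Dual (ZMod 2) F))]
    rw [Finset.sum_congr rfl (g := fun ψ : Module.Dual (ZMod 2) F =>
      (1 - (if ψ (x + y) ≠ 0 then 1 else 0) : ℤ))]
    · simp [add_comm]
    · intro ψ hψ
      by_cases hp : ψ x = ψ y <;>
        simp [Finset.ne_of_mem_erase hψ, hp, CharTwo.add_eq_zero]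
  have hc := card_dual_zmod_two F
  simp only [Finset.sum_sub_distrib, Finset.sum_const, Finset.card_univ, hc, nsmul_eq_mul,
    mul_one, ← Finset.mul_sum] at hz hcount
  zify
  linarith

end RelativeNorm

section Code

theorem sum_sgn_eq_sub_wt {m : ℕ} (c : GaloisField 2 m → ZMod 2) :
    ∑ g, sgn (c g) = Fintype.card (GaloisField 2 m) - 2 * (wt c : ℤ) := by
  have h : ∀ g, sgn (c g) = 1 - 2 * (if c g ≠ 0 then 1 else 0) := fun g => by
    rw [two_mul_ite_ne_zero, sub_sub_cancel]
  rw [Finset.sum_congr rfl fun g _ => h g, Finset.sum_sub_distrib, ← Finset.mul_sum, wt,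
    Finset.card_filter, Finset.sum_const, Finset.card_univ, nsmul_eq_mul, mul_one, Nat.cast_sum]
  congr 2
  exact Finset.sum_congr rfl fun g _ => by split_ifs <;> rfl

theorem phiF_single (m s : ℕ) (g : GaloisField 2 m) : phiF m s (Pi.single g (1 : ZMod 2)) = g ^ s := by
  change ∑ x, algebraMap (ZMod 2) (GaloisField 2 m) ((Pi.single g 1 : GaloisField 2 m → ZMod 2) x) * x ^ s = g ^ s
  rw [Fintype.sum_eq_single g fun x hx => by simp [hx]]
  simp

theorem parF_single (m : ℕ) (g : GaloisField 2 m) : parF m (Pi.single g 1) = 1 := by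
  change ∑ x, (Pi.single g 1 : GaloisField 2 m → ZMod 2) x = 1
  simp

theorem phiF_dual (m s : ℕ) (χ : Module.Dual (ZMod 2) (GaloisField 2 m))
    (c : GaloisField 2 m → ZMod 2) : χ (phiF m s c) = ∑ g, c g * χ (g ^ s) := by
  change χ (∑ g, algebraMap (ZMod 2) (GaloisField 2 m) (c g) * g ^ s) = _
  simp [← Algebra.smul_def]

theorem mem_dualCode_iff {m e : ℕ} {y : GaloisField 2 m → ZMod 2} :
    y ∈ dualCode m e ↔ ∃ (b : ZMod 2) (ψ χ : Module.Dual (ZMod 2) (GaloisField 2 m)),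
      ∀ g, y g = b + ψ g + χ (g ^ (2 ^ e + 1)) := by
  constructor
  · intro hy
    let f : Module.Dual (ZMod 2) (GaloisField 2 m → ZMod 2) :=
      ∑ g, y g • LinearMap.proj g
    let L := (parF m).prod ((phiF m 1).prod (phiF m (2 ^ e + 1)))
    have hf : f ∈ LinearMap.range L.dualMap := by
      rw [LinearMap.range_dualMap_eq_dualAnnihilator_ker, Submodule.mem_dualAnnihilator]
      intro c hc
      have hc' : c ∈ extCode m e := by
        simpa [L, extCode, and_assoc] using hc
      have := hy c hc'
      simpa [f, mul_comm] using this
    obtain ⟨k, hk⟩ := hf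
    refine ⟨k (1, 0, 0), k ∘ₗ LinearMap.inr _ _ _ ∘ₗ LinearMap.inl _ _ _,
      k ∘ₗ LinearMap.inr _ _ _ ∘ₗ LinearMap.inr _ _ _, fun g => ?_⟩
    have h1 : f (Pi.single g 1) = y g := by
      simp [f, Pi.single_apply]
    rw [← h1, ← hk]
    have h2 : L (Pi.single g 1) = (1, g, g ^ (2 ^ e + 1)) := by
      change (parF m _, phiF m 1 _, phiF m (2 ^ e + 1) _) = _
      rw [parF_single, phiF_single, phiF_single, pow_one]
    rw [LinearMap.dualMap_apply, h2]
    simp only [LinearMap.comp_apply, LinearMap.inl_apply, LinearMap.inr_apply, ← map_add]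
    simp
  · rintro ⟨b, ψ, χ, hy⟩ c hc
    obtain ⟨⟨h1, h2⟩, h3⟩ := hc
    have h1' : ∑ g, c g = 0 := h1
    have h2' := phiF_dual m 1 ψ c
    have h3' := phiF_dual m (2 ^ e + 1) χ c
    rw [LinearMap.mem_ker.1 h2, map_zero] at h2'
    rw [LinearMap.mem_ker.1 h3, map_zero] at h3'
    simp only [pow_one] at h2'
    simp only [hy, mul_add, Finset.sum_add_distrib, ← h2', ← h3', ← Finset.sum_mul, h1',
      zero_mul, add_zero]

variable {m e : ℕ}

theorem mem_dualCode_cases (he : e ≠ 0) (hF : Fintype.card (GaloisField 2 m) = (2 ^ e) ^ 2)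
    (h : ∀ g : GaloisField 2 m, (g ^ 2 ^ e) ^ 2 ^ e = g) {y : GaloisField 2 m → ZMod 2} :
    y ∈ dualCode m e ↔ (∃ b p, p.1 ≠ 0 ∧ y = normWord h b p) ∨
      ∃ (b : ZMod 2) (ψ : Module.Dual (ZMod 2) (GaloisField 2 m)), y = fun g => ψ g + b := by
  rw [mem_dualCode_iff]
  constructor
  · rintro ⟨b, ψ, χ, hy⟩
    have hχ : ∀ g, χ (g ^ (2 ^ e + 1)) =
        (χ ∘ₗ (frobFixed (GaloisField 2 m) e).subtype) (relNorm h g) := fun g => rfl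
    by_cases h0 : χ ∘ₗ (frobFixed (GaloisField 2 m) e).subtype = 0
    · refine Or.inr ⟨b, ψ, funext fun g => ?_⟩
      rw [hy, hχ, h0, LinearMap.zero_apply, add_zero, add_comm]
    · obtain ⟨u, rfl⟩ := (traceForm_bijective he hF h h0).2 ψ
      refine Or.inl ⟨b + (χ ∘ₗ (frobFixed (GaloisField 2 m) e).subtype) (relNorm h u),
        (_, u), h0, funext fun g => ?_⟩
      rw [hy, hχ, normWord, dual_relNorm_add]
      linear_combination -CharTwo.add_self_eq_zero
        ((χ ∘ₗ (frobFixed (GaloisField 2 m) e).subtype) (relNorm h u))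
  · rintro (⟨b, ⟨φ, u⟩, -, rfl⟩ | ⟨b, ψ, rfl⟩)
    · obtain ⟨χ, rfl⟩ := LinearMap.exists_extend φ
      refine ⟨b + (χ ∘ₗ (frobFixed (GaloisField 2 m) e).subtype) (relNorm h u),
        traceForm h (χ ∘ₗ (frobFixed (GaloisField 2 m) e).subtype) u, χ, fun g => ?_⟩
      rw [normWord, dual_relNorm_add]
      change χ (g ^ (2 ^ e + 1)) + _ + _ + _ = _
      ring
    · exact ⟨b, ψ, 0, fun g => by simp [add_comm]⟩

theorem sum_sgn_normWord (he : e ≠ 0) (hF : Fintype.card (GaloisField 2 m) = (2 ^ e) ^ 2)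
    (h : ∀ g : GaloisField 2 m, (g ^ 2 ^ e) ^ 2 ^ e = g) (b : ZMod 2)
    {p : Module.Dual (ZMod 2) (frobFixed (GaloisField 2 m) e) × GaloisField 2 m}
    (hp : p.1 ≠ 0) : ∑ g, sgn (normWord h b p g) = -(2 ^ e * sgn b) := by
  simp_rw [normWord, sgn_add, ← Finset.sum_mul, sum_sgn_relNorm_add he hF h hp]
  ring

theorem sum_sgn_affine_of_ne_zero {ψ : Module.Dual (ZMod 2) (GaloisField 2 m)} (hψ : ψ ≠ 0)
    (b : ZMod 2) : ∑ g, sgn (ψ g + b) = 0 := by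
  simp_rw [sgn_add, ← Finset.sum_mul, sum_sgn_eq_zero hψ, zero_mul]

theorem sum_sgn_const (hF : Fintype.card (GaloisField 2 m) = (2 ^ e) ^ 2) (b : ZMod 2) :
    ∑ g, sgn ((0 : Module.Dual (ZMod 2) (GaloisField 2 m)) g + b) = (2 ^ e) ^ 2 * sgn b := by
  simp [hF]

theorem sgn_eq_one_or (b : ZMod 2) : sgn b = 1 ∨ sgn b = -1 := by
  revert b; decide

theorem sgn_injective : Function.Injective sgn := by decide

theorem exists_normWord_iff (he : e ≠ 0) (hF : Fintype.card (GaloisField 2 m) = (2 ^ e) ^ 2)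
    (h : ∀ g : GaloisField 2 m, (g ^ 2 ^ e) ^ 2 ^ e = g) (b : ZMod 2)
    (c : GaloisField 2 m → ZMod 2) :
    (c ∈ dualCode m e ∧ ∑ g, sgn (c g) = -(2 ^ e * sgn b)) ↔
      ∃ p, p.1 ≠ 0 ∧ normWord h b p = c := by
  have hq : (1 : ℤ) < 2 ^ e := one_lt_pow₀ (by norm_num) he
  rw [mem_dualCode_cases he hF h]
  constructor
  · rintro ⟨⟨b', p, hp, rfl⟩ | ⟨b', ψ, rfl⟩, hs⟩
    · rw [sum_sgn_normWord he hF h b' hp, neg_inj] at hs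
      rw [← sgn_injective (mul_left_cancel₀ (by positivity) hs)]
      exact ⟨p, hp, rfl⟩
    · by_cases hψ : ψ = 0
      · subst hψ
        rw [sum_sgn_const hF] at hs
        rcases sgn_eq_one_or b with hb | hb <;> rcases sgn_eq_one_or b' with hb' | hb' <;>
          rw [hb, hb'] at hs <;> nlinarith
      · rw [sum_sgn_affine_of_ne_zero hψ] at hs
        rcases sgn_eq_one_or b with hb | hb <;> rw [hb] at hs <;> linarith
  · rintro ⟨p, hp, rfl⟩
    exact ⟨Or.inl ⟨b, p, hp, rfl⟩, sum_sgn_normWord he hF h b hp⟩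

theorem exists_affine_iff (he : e ≠ 0) (hF : Fintype.card (GaloisField 2 m) = (2 ^ e) ^ 2)
    (c : GaloisField 2 m → ZMod 2) :
    (c ∈ dualCode m e ∧ ∑ g, sgn (c g) = 0) ↔
      ∃ (b : ZMod 2) (ψ : Module.Dual (ZMod 2) (GaloisField 2 m)),
        ψ ≠ 0 ∧ c = fun g => ψ g + b := by
  have hq : (2 : ℤ) ^ e ≠ 0 := by positivity
  have hsgn : ∀ b, sgn b ≠ 0 := by decide
  rw [mem_dualCode_cases he hF (frob_frob_of_card hF)]
  constructor
  · rintro ⟨⟨b, p, hp, rfl⟩ | ⟨b, ψ, rfl⟩, hs⟩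
    · rw [sum_sgn_normWord he hF _ b hp] at hs
      simp [hsgn] at hs
    · refine ⟨b, ψ, ?_, rfl⟩
      rintro rfl
      rw [sum_sgn_const hF] at hs
      simp [hsgn] at hs
  · rintro ⟨b, ψ, hψ, rfl⟩
    exact ⟨Or.inr ⟨b, ψ, rfl⟩, sum_sgn_affine_of_ne_zero hψ b⟩

theorem card_codewords_normWord (he : e ≠ 0)
    (hF : Fintype.card (GaloisField 2 m) = (2 ^ e) ^ 2) (b : ZMod 2)
    {x y : GaloisField 2 m} (hxy : x ≠ y) :
    (4 : ℤ) * Nat.card {c : GaloisField 2 m → ZMod 2 //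
      (c ∈ dualCode m e ∧ ∑ g, sgn (c g) = -(2 ^ e * sgn b)) ∧ c x ≠ 0 ∧ c y ≠ 0} =
      (2 ^ e - 1) * ((2 ^ e) ^ 2 + 2 * sgn b * 2 ^ e) := by
  have h := frob_frob_of_card hF
  rw [← card_normWord_pair he hF h b hxy]
  congr 2
  have himage : {c : GaloisField 2 m → ZMod 2 | (c ∈ dualCode m e ∧
      ∑ g, sgn (c g) = -(2 ^ e * sgn b)) ∧ c x ≠ 0 ∧ c y ≠ 0} = normWord h b ''
        {p | p.1 ≠ 0 ∧ normWord h b p x ≠ 0 ∧ normWord h b p y ≠ 0} := by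
    ext c
    rw [Set.mem_ofPred_eq, exists_normWord_iff he hF h]
    constructor
    · rintro ⟨⟨p, hp, rfl⟩, hc⟩
      exact ⟨p, ⟨hp, hc⟩, rfl⟩
    · rintro ⟨p, ⟨hp, hc⟩, rfl⟩
      exact ⟨⟨p, hp, rfl⟩, hc⟩
  change Set.ncard {c : GaloisField 2 m → ZMod 2 | _} = Set.ncard {p | _}
  rw [himage, Set.InjOn.ncard_image ((normWord_injOn he hF h b).mono fun p hp => hp.1)]

theorem card_codewords_affine (he : e ≠ 0)
    (hF : Fintype.card (GaloisField 2 m) = (2 ^ e) ^ 2)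
    {x y : GaloisField 2 m} (hxy : x ≠ y) :
    2 * Nat.card {c : GaloisField 2 m → ZMod 2 //
      (c ∈ dualCode m e ∧ ∑ g, sgn (c g) = 0) ∧ c x ≠ 0 ∧ c y ≠ 0} + 2 = (2 ^ e) ^ 2 := by
  rw [← hF, ← card_dual_pair hxy]
  congr 2
  have htwo : ∀ a b : ZMod 2, a + b ≠ 0 ↔ b = a + 1 := by decide
  have himage : {c : GaloisField 2 m → ZMod 2 | (c ∈ dualCode m e ∧
      ∑ g, sgn (c g) = 0) ∧ c x ≠ 0 ∧ c y ≠ 0} =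
        (fun (ψ : Module.Dual (ZMod 2) (GaloisField 2 m)) g => ψ g + (ψ x + 1)) ''
        {ψ | ψ ≠ 0 ∧ ψ x = ψ y} := by
    ext c
    rw [Set.mem_ofPred_eq, exists_affine_iff he hF]
    constructor
    · rintro ⟨⟨b, ψ, hψ, rfl⟩, hx, hy⟩
      rw [htwo] at hx hy
      subst hx
      exact ⟨ψ, ⟨hψ, by simpa using hy⟩, rfl⟩
    · rintro ⟨ψ, ⟨hψ, hc⟩, rfl⟩
      exact ⟨⟨_, ψ, hψ, rfl⟩, (htwo _ _).2 rfl, (htwo _ _).2 (by rw [hc])⟩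
  change Set.ncard {c : GaloisField 2 m → ZMod 2 | _} = Set.ncard {ψ | _}
  rw [himage, Set.ncard_image_of_injective]
  intro ψ ψ' heq
  have h0 : ψ x = ψ' x := by simpa using congrFun heq 0
  ext g
  simpa [h0] using congrFun heq g

end Code

/-- When `m ≥ 4` is even and `e = m/2`, the supports of the weight-`k` codewords of
`C̄_e^⊥` form 2-designs with the listed parameters `(k,λ)`. -/
theorem dualCode_designs_e_eq_half_m (m e : ℕ) (hm : 4 ≤ m)
    (hmeven : Even m) (he : e = m / 2)
    (x y : GaloisField 2 m) (hxy : x ≠ y) :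
    Nat.card {c : GaloisField 2 m → ZMod 2 // c ∈ dualCode m e ∧
        wt c = 2 ^ (m - 1) - 2 ^ ((m - 2) / 2) ∧ c x ≠ 0 ∧ c y ≠ 0} =
      2 ^ ((m - 2) / 2) * (2 ^ (m / 2) - 1) * (2 ^ ((m - 2) / 2) - 1) ∧
    Nat.card {c : GaloisField 2 m → ZMod 2 // c ∈ dualCode m e ∧
        wt c = 2 ^ (m - 1) + 2 ^ ((m - 2) / 2) ∧ c x ≠ 0 ∧ c y ≠ 0} =
      2 ^ ((m - 2) / 2) * (2 ^ (m / 2) - 1) * (2 ^ ((m - 2) / 2) + 1) ∧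
    Nat.card {c : GaloisField 2 m → ZMod 2 // c ∈ dualCode m e ∧
        wt c = 2 ^ (m - 1) ∧ c x ≠ 0 ∧ c y ≠ 0} = 2 ^ (m - 1) - 1 := by
  obtain ⟨n, rfl⟩ : ∃ n, e = n + 1 := ⟨e - 1, by omega⟩
  obtain ⟨k, hk⟩ := hmeven
  have hF : Fintype.card (GaloisField 2 m) = (2 ^ (n + 1)) ^ 2 := by
    rw [← Nat.card_eq_fintype_card, GaloisField.card 2 m (by omega), ← pow_mul]
    congr 1
    omega
  rw [show m - 1 = n + n + 1 by omega, show (m - 2) / 2 = n by omega, ← he]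
  have hn : n + 1 ≠ 0 := n.succ_ne_zero
  have hr : 1 ≤ 2 ^ n := Nat.one_le_two_pow
  have hplus := card_codewords_normWord hn hF 0 hxy
  have hminus := card_codewords_normWord hn hF 1 hxy
  have hmid := card_codewords_affine hn hF hxy
  simp only [sum_sgn_eq_sub_wt, hF, and_assoc] at hplus hminus hmid
  have e1 : ∀ w : ℕ, w = 2 ^ (n + n + 1) - 2 ^ n ↔
      (((2 ^ (n + 1)) ^ 2 : ℕ) : ℤ) - 2 * (w : ℤ) = -(2 ^ (n + 1) * sgn 1) := by
    intro w
    have hle : 2 ^ n ≤ 2 ^ (n + n + 1) := Nat.pow_le_pow_right (by norm_num) (by omega)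
    rw [← Nat.cast_inj (R := ℤ), Nat.cast_sub hle]
    simp only [sgn, one_ne_zero, if_false]
    push_cast
    ring_nf
    constructor <;> intro h <;> linarith
  have e2 : ∀ w : ℕ, w = 2 ^ (n + n + 1) + 2 ^ n ↔
      (((2 ^ (n + 1)) ^ 2 : ℕ) : ℤ) - 2 * (w : ℤ) = -(2 ^ (n + 1) * sgn 0) := by
    intro w
    rw [← Nat.cast_inj (R := ℤ)]
    simp only [sgn, if_true]
    push_cast
    ring_nf
    constructor <;> intro h <;> linarith
  have e3 : ∀ w : ℕ, w = 2 ^ (n + n + 1) ↔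
      (((2 ^ (n + 1)) ^ 2 : ℕ) : ℤ) - 2 * (w : ℤ) = 0 := by
    intro w
    rw [← Nat.cast_inj (R := ℤ)]
    push_cast
    ring_nf
    constructor <;> intro h <;> linarith
  simp only [← e1, ← e2, ← e3] at hplus hminus hmid
  refine ⟨?_, ?_, ?_⟩
  · generalize Nat.card _ = M at hminus ⊢
    zify [hr, Nat.one_le_two_pow (n := n + 1)]
    simp only [sgn, one_ne_zero, if_false] at hminus
    rw [pow_succ] at hminus ⊢
    linarith
  · generalize Nat.card _ = M at hplus ⊢
    zify [Nat.one_le_two_pow (n := n + 1)]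
    simp only [sgn, if_true] at hplus
    rw [pow_succ] at hplus ⊢
    linarith
  · have : (2 ^ (n + 1)) ^ 2 = 2 * 2 ^ (n + n + 1) := by ring
    omega
end

section
/- (Assmus–Mattson Theorem) Let F be a finite field with q elements and let C ⊆ F^v be a linear code with minimum distance d, and let C^⊥ be its dual, with minimum distance d^⊥. Let (A_i)_{i=0}^v and (A_i^⊥)_{i=0}^v be the weight distributions of C and C^⊥. Let w be the largest integer with w ≤ v and w − ⌊(w+q−2)/(q−1)⌋ < d, and let w^⊥ be the largest integer with w^⊥ ≤ v and w^⊥ − ⌊(w^⊥+q−2)/(q−1)⌋ < d^⊥. Fix a positive integer t < d and let s be the number of indices i with 1 ≤ i ≤ v−t and A_i^⊥ ≠ 0. Suppose s ≤ d−t. Then: (1) for every i with d ≤ i ≤ w and A_i ≠ 0, the set of supports of the codewords of C of weight i forms a t-design on the coordinate set (every t-element subset of coordinates is contained in the same number of these distinct supports); and (2) for every i with d^⊥ ≤ i ≤ min{v−t, w^⊥} and A_i^⊥ ≠ 0, the set of supports of the codewords of C^⊥ of weight i forms a t-design on the coordinate set. -/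
/-- The Hamming weight of a vector. -/
def hwt {F : Type*} [Zero F] [DecidableEq F] {v : ℕ} (x : Fin v → F) : ℕ :=
  (Finset.univ.filter fun i => x i ≠ 0).card

/-- The support of a vector. -/
def hsupp {F : Type*} [Zero F] [DecidableEq F] {v : ℕ} (x : Fin v → F) : Finset (Fin v) :=
  Finset.univ.filter fun i => x i ≠ 0

/-- The dual of a linear code of length `v` over a field `F`. -/
def dualF {F : Type*} [Field F] {v : ℕ} (C : Submodule F (Fin v → F)) :
    Submodule F (Fin v → F) where
  carrier := {y | ∀ x ∈ C, ∑ i, x i * y i = 0}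
  add_mem' := by
    intro a b ha hb x hx
    simp only [Pi.add_apply, mul_add, Finset.sum_add_distrib, ha x hx, hb x hx, add_zero]
  zero_mem' := by intro x hx; simp
  smul_mem' := by
    intro a y hy x hx
    simp only [Pi.smul_apply, smul_eq_mul, mul_left_comm, ← Finset.mul_sum, hy x hx, mul_zero]

/-- The number of codewords of weight `i` in a code `C` (the weight distribution). -/
noncomputable def Awt {F : Type*} [Field F] [DecidableEq F] {v : ℕ}
    (C : Submodule F (Fin v → F)) (i : ℕ) : ℕ :=
  Nat.card {x : Fin v → F // x ∈ C ∧ hwt x = i}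

namespace AssmusMattson

open Finset

lemma exists_perm_map_eq {α : Type*} [Fintype α] [DecidableEq α] {U U' : Finset α}
    (h : #U = #U') : ∃ σ : Equiv.Perm α, U.map σ.toEmbedding = U' := by
  let e : {x // x ∈ U} ≃ {x // x ∈ U'} := equivOfCardEq h
  refine ⟨e.extendSubtype, eq_of_subset_of_card_le (fun x hx => ?_) (by simp [h])⟩
  obtain ⟨a, ha, rfl⟩ := mem_map.1 hx
  exact e.extendSubtype_mem a ha

lemma eq_zero_of_forall_sum_mul_pow_eq_zero {ι R : Type*} [CommRing R] [IsDomain R] {J : Finset ι}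
    {b g : ι → R} (hg : Set.InjOn g J)
    (h : ∀ r < #J, ∑ j ∈ J, b j * g j ^ r = 0) : ∀ j ∈ J, b j = 0 := by
  classical
  intro j hj
  let p : Polynomial R := ∏ k ∈ J.erase j, (Polynomial.X - Polynomial.C (g k))
  have hdeg : p.natDegree < #J := by
    rw [Polynomial.natDegree_finsetProd_X_sub_C_eq_card, card_erase_of_mem hj]
    exact Nat.sub_lt (card_pos.2 ⟨j, hj⟩) one_pos
  have hp : ∑ k ∈ J, b k * p.eval (g k) = 0 := by
    simp only [Polynomial.eval_eq_sum_range' hdeg, mul_sum]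
    rw [sum_comm]
    refine sum_eq_zero fun r hr => ?_
    have := h r (mem_range.1 hr)
    simp only [mul_left_comm _ (p.coeff r), ← mul_sum, this, mul_zero]
  rw [sum_eq_single_of_mem j hj fun k hk hkj => ?_] at hp
  · refine (mul_eq_zero.1 hp).resolve_right ?_
    simp only [p, Polynomial.eval_prod, prod_ne_zero_iff, Polynomial.eval_sub, Polynomial.eval_X,
      Polynomial.eval_C, sub_ne_zero]
    intro k hk hjk
    exact (ne_of_mem_erase hk) (hg (mem_of_mem_erase hk) hj hjk.symm)
  · simp only [p, Polynomial.eval_prod]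
    rw [prod_eq_zero (mem_erase.2 ⟨hkj, hk⟩) (by simp), mul_zero]

lemma sum_powerset_eq_of_card {α M : Type*} [Fintype α] [DecidableEq α] [AddCommMonoid M] {n : ℕ}
    {f : Finset α → M} (hf : ∀ U U' : Finset α, #U = #U' → #U ≤ n → f U = f U')
    {T T' : Finset α} (hT : #T = n) (hT' : #T' = n) :
    ∑ U ∈ T.powerset, f U = ∑ U ∈ T'.powerset, f U := by
  obtain ⟨σ, rfl⟩ := exists_perm_map_eq (hT.trans hT'.symm)
  refine sum_equiv σ.finsetCongr (fun U => ?_) fun U hU => ?_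
  · simp [Equiv.finsetCongr_apply, map_subset_map]
  · refine hf _ _ (by simp) ((card_le_card (mem_powerset.1 hU)).trans hT.le)

lemma sum_powerset_neg_one_pow_disjoint {α R : Type*} [DecidableEq α] [CommRing R]
    (S T : Finset α) :
    ∑ U ∈ T.powerset, (-1 : R) ^ #U * (if Disjoint U S then 1 else 0) =
      if T ⊆ S then 1 else 0 := by
  have h := prod_add (fun i => (-1 : R) * if i ∉ S then 1 else 0) (fun _ => 1) T
  simp only [prod_mul_distrib, prod_const, prod_boole, one_pow, mul_one] at h
  simp only [Finset.disjoint_left, Finset.subset_iff]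
  rw [← h, ← prod_boole]
  refine prod_congr rfl fun i _ => ?_
  by_cases hi : i ∈ S <;> simp [hi]

lemma sum_powerset_neg_one_pow_mul_pow_sdiff {α R : Type*} [DecidableEq α] [CommRing R]
    (S T : Finset α) (w : R) :
    ∑ U ∈ T.powerset, (-1 : R) ^ #U * w ^ #(S \ U) =
      if T ⊆ S then w ^ #(S \ T) * (w - 1) ^ #T else 0 := by
  have h := prod_add (fun _ => (-1 : R)) (fun i => if i ∈ S then w else 1) T
  have hprod : ∏ i ∈ T, (-1 + if i ∈ S then w else 1) = if T ⊆ S then (w - 1) ^ #T else 0 := by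
    have : ∀ i ∈ T, (-1 + if i ∈ S then w else 1) = (w - 1) * if i ∈ S then 1 else 0 := by
      intro i _
      split_ifs <;> ring
    rw [prod_congr rfl this, prod_mul_distrib, prod_boole, prod_const, mul_ite, mul_one, mul_zero]
    rfl
  rw [hprod] at h
  have h' := congrArg (w ^ #(S \ T) * ·) h
  simp only [mul_ite, mul_zero] at h'
  rw [h', mul_sum]
  refine sum_congr rfl fun U hU => ?_
  have hcard : #(S \ U) = #(S \ T) + #{i ∈ T \ U | i ∈ S} := by
    rw [← card_union_of_disjoint]
    · congr 1
      ext i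
      have : i ∈ U → i ∈ T := fun h => mem_powerset.1 hU h
      simp only [mem_sdiff, mem_union, mem_filter]
      tauto
    · rw [Finset.disjoint_left]
      simp only [mem_sdiff, mem_filter]
      tauto
  rw [hcard, prod_ite, prod_const, prod_const_one, prod_const, pow_add]
  ring

lemma sum_powerset_disjoint_pow {α R : Type*} [DecidableEq α] [CommSemiring R]
    (S A : Finset α) (a : R) :
    ∑ W ∈ A.powerset, (if Disjoint W S then a ^ #W else 0) = (a + 1) ^ #(A \ S) := by
  rw [← sum_pow_mul_eq_add_pow, ← sum_filter]
  refine sum_congr ?_ fun W _ => by simp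
  ext W
  simp [subset_sdiff]

lemma sum_powerset_superset_pow {α R : Type*} [DecidableEq α] [CommSemiring R]
    {S A : Finset α} (hSA : S ⊆ A) (a : R) :
    ∑ W ∈ A.powerset, (if S ⊆ W then a ^ #W else 0) = a ^ #S * (a + 1) ^ #(A \ S) := by
  have h := prod_add (fun _ => a) (fun i => if i ∉ S then 1 else 0) A
  simp only [prod_const, prod_boole, mul_ite, mul_one, mul_zero] at h
  have hprod : ∏ i ∈ A, (a + if i ∉ S then 1 else 0) = a ^ #S * (a + 1) ^ #(A \ S) := by
    rw [← prod_sdiff hSA, mul_comm]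
    congr 1
    · rw [← prod_const]
      exact prod_congr rfl fun i hi => by simp [hi]
    · rw [← prod_const]
      exact prod_congr rfl fun i hi => by simp [(mem_sdiff.1 hi).2]
  rw [← hprod, h]
  refine sum_congr rfl fun W _ => if_congr ?_ rfl rfl
  refine ⟨fun hSW i hi hiS => (mem_sdiff.1 hi).2 (hSW hiS), fun hW i hi => ?_⟩
  by_contra hiW
  exact hW i (mem_sdiff.2 ⟨hSA hi, hiW⟩) hi

section Duality

variable {F : Type*} [Field F] {v : ℕ}

lemma mem_dualF {C : Submodule F (Fin v → F)} {y : Fin v → F} :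
    y ∈ dualF C ↔ ∀ x ∈ C, ∑ i, x i * y i = 0 := Iff.rfl

lemma dualF_eq_orthogonal (C : Submodule F (Fin v → F)) :
    dualF C = LinearMap.BilinForm.orthogonal (Matrix.toBilin' (1 : Matrix (Fin v) (Fin v) F)) C := by
  ext y
  simp only [mem_dualF, LinearMap.BilinForm.mem_orthogonal_iff, Matrix.toBilin'_apply',
    Matrix.one_mulVec, dotProduct]

lemma nondegenerate_toBilin'_one :
    (Matrix.toBilin' (1 : Matrix (Fin v) (Fin v) F)).Nondegenerate :=
  Matrix.Nondegenerate.toBilin' (Matrix.nondegenerate_of_det_ne_zero (by simp))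

lemma finrank_dualF_add (C : Submodule F (Fin v → F)) :
    Module.finrank F (dualF C) + Module.finrank F C = v := by
  have h := LinearMap.BilinForm.finrank_orthogonal nondegenerate_toBilin'_one C
  have hle := Submodule.finrank_le C
  rw [dualF_eq_orthogonal, h]
  simp only [Module.finrank_fin_fun] at hle ⊢
  omega

lemma dualF_dualF (C : Submodule F (Fin v → F)) : dualF (dualF C) = C := by
  refine (Submodule.eq_of_le_of_finrank_eq (fun x hx y hy => ?_) ?_).symm
  · simpa only [mul_comm] using hy x hx
  · have h₁ := finrank_dualF_add C
    have h₂ := finrank_dualF_add (dualF C)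
    omega

lemma dualF_sup (C D : Submodule F (Fin v → F)) : dualF (C ⊔ D) = dualF C ⊓ dualF D := by
  ext y
  simp only [Submodule.mem_inf, mem_dualF]
  refine ⟨fun h => ⟨fun x hx => h x (Submodule.mem_sup_left hx),
    fun x hx => h x (Submodule.mem_sup_right hx)⟩, fun h x hx => ?_⟩
  obtain ⟨a, ha, b, hb, rfl⟩ := Submodule.mem_sup.1 hx
  simp only [Pi.add_apply, add_mul, sum_add_distrib, h.1 a ha, h.2 b hb, add_zero]

/-- The vectors that vanish at every coordinate in `W`. -/
def vanishOn (F : Type*) [Field F] {v : ℕ} (W : Finset (Fin v)) : Submodule F (Fin v → F) :=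
  LinearMap.ker (LinearMap.funLeft F F (Subtype.val : W → Fin v))

lemma mem_vanishOn {W : Finset (Fin v)} {x : Fin v → F} :
    x ∈ vanishOn F W ↔ ∀ i ∈ W, x i = 0 := by
  simp [vanishOn, funext_iff, LinearMap.funLeft_apply]

lemma finrank_vanishOn_add (W : Finset (Fin v)) :
    Module.finrank F (vanishOn F W) + #W = v := by
  have h := LinearMap.finrank_range_add_finrank_ker
    (LinearMap.funLeft F F (Subtype.val : W → Fin v))
  rw [LinearMap.range_eq_top.2
    (LinearMap.funLeft_surjective_of_injective F F _ Subtype.val_injective), finrank_top] at h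
  simp only [Module.finrank_fintype_fun_eq_card, Fintype.card_coe, Fintype.card_fin] at h
  rw [vanishOn]
  omega

lemma dualF_vanishOn (W : Finset (Fin v)) : dualF (vanishOn F W) = vanishOn F Wᶜ := by
  ext y
  rw [mem_dualF, mem_vanishOn]
  constructor
  · intro h i hi
    have := h (Pi.single i 1) (mem_vanishOn.2 fun j hj => by
      rw [Pi.single_eq_of_ne]
      rintro rfl
      exact (mem_compl.1 hi) hj)
    simpa [Pi.single_apply] using this
  · intro h x hx
    refine sum_eq_zero fun i _ => ?_
    by_cases hi : i ∈ W
    · rw [mem_vanishOn.1 hx i hi, zero_mul]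
    · rw [h i (mem_compl.2 hi), mul_zero]

lemma finrank_add_finrank_dualF_inf (C : Submodule F (Fin v → F)) (W : Finset (Fin v)) :
    Module.finrank F C + Module.finrank F (dualF C ⊓ vanishOn F Wᶜ : Submodule F (Fin v → F)) =
      #W + Module.finrank F (C ⊓ vanishOn F W : Submodule F (Fin v → F)) := by
  have h₁ := finrank_dualF_add (C ⊔ vanishOn F W)
  rw [dualF_sup, dualF_vanishOn] at h₁
  have h₂ := Submodule.finrank_sup_add_finrank_inf_eq C (vanishOn F W)
  have h₃ := finrank_vanishOn_add (F := F) W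
  omega

end Duality

section Counting

variable {F : Type*} [Field F] {v : ℕ}

lemma mem_hsupp [DecidableEq F] {x : Fin v → F} {i : Fin v} : i ∈ hsupp x ↔ x i ≠ 0 := by
  simp [hsupp]

lemma disjoint_hsupp_iff [DecidableEq F] {W : Finset (Fin v)} {x : Fin v → F} :
    Disjoint W (hsupp x) ↔ ∀ i ∈ W, x i = 0 := by
  simp [Finset.disjoint_left, mem_hsupp]

lemma hsupp_subset_iff [DecidableEq F] {W : Finset (Fin v)} {x : Fin v → F} :
    hsupp x ⊆ W ↔ ∀ i ∈ Wᶜ, x i = 0 := by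
  rw [← disjoint_hsupp_iff, disjoint_comm, disjoint_compl_right_iff]

lemma hwt_add_card_le_of_disjoint [DecidableEq F] {x : Fin v → F} {U : Finset (Fin v)}
    (h : Disjoint U (hsupp x)) : hwt x + #U ≤ v := by
  have := card_le_univ (U ∪ hsupp x)
  rw [card_union_of_disjoint h, Fintype.card_fin] at this
  rw [add_comm]
  exact this

lemma hwt_le [DecidableEq F] (x : Fin v → F) : hwt x ≤ v := by
  simpa using hwt_add_card_le_of_disjoint (disjoint_empty_left (hsupp x))

lemma hwt_eq_zero [DecidableEq F] {x : Fin v → F} : hwt x = 0 ↔ x = 0 := by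
  simp [hwt, funext_iff, filter_eq_empty_iff]

lemma sum_comp_hwt [DecidableEq F] {M : Type*} [Semiring M] (s : Finset (Fin v → F)) (f : ℕ → M) :
    ∑ x ∈ s, f (hwt x) = ∑ j ∈ range (v + 1), (#{x ∈ s | hwt x = j} : M) * f j := by
  rw [← sum_fiberwise_of_maps_to (t := range (v + 1)) (g := hwt)
    fun x _ => mem_range.2 (Nat.lt_succ_of_le (hwt_le x))]
  refine sum_congr rfl fun j _ => ?_
  rw [sum_congr rfl fun x hx => by rw [(mem_filter.1 hx).2], sum_const, nsmul_eq_mul]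

variable [Fintype F]

open Classical in
/-- The codewords of `C`, as a finset. -/
noncomputable def words (C : Submodule F (Fin v → F)) : Finset (Fin v → F) :=
  univ.filter (· ∈ C)

lemma mem_words {C : Submodule F (Fin v → F)} {x : Fin v → F} : x ∈ words C ↔ x ∈ C := by
  simp [words]

lemma card_words (C : Submodule F (Fin v → F)) :
    #(words C) = Fintype.card F ^ Module.finrank F C := by
  classical
  rw [← Module.card_eq_pow_finrank (K := F) (V := C), Fintype.card_subtype]
  congr 1

variable [DecidableEq F]

/-- The MacWilliams identity in subset form. -/
lemma card_words_mul_card_subset (C : Submodule F (Fin v → F)) (W : Finset (Fin v)) :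
    #(words C) * #{y ∈ words (dualF C) | hsupp y ⊆ W} =
      Fintype.card F ^ #W * #{x ∈ words C | Disjoint W (hsupp x)} := by
  have h₁ : {y ∈ words (dualF C) | hsupp y ⊆ W} = words (dualF C ⊓ vanishOn F Wᶜ) := by
    ext y
    simp only [mem_filter, mem_words, Submodule.mem_inf, mem_vanishOn, hsupp_subset_iff]
  have h₂ : {x ∈ words C | Disjoint W (hsupp x)} = words (C ⊓ vanishOn F W) := by
    ext y
    simp only [mem_filter, mem_words, Submodule.mem_inf, mem_vanishOn, disjoint_hsupp_iff]
  rw [h₁, h₂, card_words, card_words, card_words, ← pow_add, ← pow_add,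
    finrank_add_finrank_dualF_inf]

lemma card_subset_eq_one {C : Submodule F (Fin v → F)} {d : ℕ}
    (hC : ∀ x ∈ C, x ≠ 0 → d ≤ hwt x) {W : Finset (Fin v)} (hW : #W < d) :
    #{x ∈ words C | hsupp x ⊆ W} = 1 := by
  rw [card_eq_one]
  refine ⟨0, ?_⟩
  ext x
  simp only [mem_filter, mem_words, mem_singleton]
  constructor
  · rintro ⟨hx, hxW⟩
    by_contra h0
    exact absurd (hC x hx h0) (not_le.2 ((card_le_card hxW).trans_lt hW))
  · rintro rfl
    exact ⟨C.zero_mem, by simp [hsupp]⟩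

lemma card_disjoint_dualF_eq {C : Submodule F (Fin v → F)} {d : ℕ}
    (hC : ∀ x ∈ C, x ≠ 0 → d ≤ hwt x) {W W' : Finset (Fin v)} (hWW' : #W = #W')
    (hW : #W < d) :
    #{y ∈ words (dualF C) | Disjoint W (hsupp y)} =
      #{y ∈ words (dualF C) | Disjoint W' (hsupp y)} := by
  have h := card_words_mul_card_subset (dualF C) W
  have h' := card_words_mul_card_subset (dualF C) W'
  rw [dualF_dualF, card_subset_eq_one hC hW] at h
  rw [dualF_dualF, card_subset_eq_one hC (hWW' ▸ hW), h, hWW'] at h'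
  exact Nat.eq_of_mul_eq_mul_left (pow_pos Fintype.card_pos _) h'

lemma sum_pow_zeros_eq (C : Submodule F (Fin v → F)) (U : Finset (Fin v)) (r : ℕ) :
    ∑ y ∈ words C with Disjoint U (hsupp y), (v - hwt y) ^ r =
      ∑ f : Fin r → Fin v, #{y ∈ words C | Disjoint (U ∪ univ.image f) (hsupp y)} := by
  have hpow (y : Fin v → F) :
      (v - hwt y) ^ r = #{f : Fin r → Fin v | Disjoint (univ.image f) (hsupp y)} := by
    have h : #(hsupp y)ᶜ = v - hwt y := by rw [card_compl, Fintype.card_fin]; rfl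
    rw [← h, ← Fintype.card_piFinset_const]
    congr 1
    ext f
    simp [disjoint_hsupp_iff, mem_hsupp]
  simp only [hpow, card_filter, sum_filter, disjoint_union_left, ite_and]
  rw [sum_comm]
  refine sum_congr rfl fun y _ => ?_
  split_ifs <;> simp

lemma sum_pow_zeros_dualF_eq {C : Submodule F (Fin v → F)} {d r : ℕ}
    (hC : ∀ x ∈ C, x ≠ 0 → d ≤ hwt x) {U U' : Finset (Fin v)} (hU : #U = #U')
    (hr : #U + r < d) :
    ∑ y ∈ words (dualF C) with Disjoint U (hsupp y), (v - hwt y) ^ r =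
      ∑ y ∈ words (dualF C) with Disjoint U' (hsupp y), (v - hwt y) ^ r := by
  rw [sum_pow_zeros_eq, sum_pow_zeros_eq]
  obtain ⟨σ, rfl⟩ := exists_perm_map_eq hU
  refine Fintype.sum_equiv ((Equiv.refl (Fin r)).arrowCongr σ) _ _ fun f => ?_
  have himage : U.map σ.toEmbedding ∪ univ.image ((Equiv.refl (Fin r)).arrowCongr σ f) =
      (U ∪ univ.image f).map σ.toEmbedding := by
    rw [map_union, map_eq_image σ.toEmbedding (univ.image f), image_image]
    rfl
  rw [himage]
  refine card_disjoint_dualF_eq hC (card_map _).symm ((card_union_le _ _).trans_lt ?_)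
  have : #(univ.image f) ≤ r := card_image_le.trans (by simp)
  omega

lemma Awt_eq (C : Submodule F (Fin v → F)) (i : ℕ) :
    Awt C i = #{x ∈ words C | hwt x = i} := by
  classical
  rw [Awt, Nat.card_eq_fintype_card, Fintype.card_subtype]
  congr 1
  ext x
  simp [mem_words]

/-- The weight distribution of the words of `dualF C` vanishing on `U` depends only on `#U`. -/
lemma card_disjoint_hwt_dualF_eq {C : Submodule F (Fin v → F)} {d : ℕ}
    (hC : ∀ x ∈ C, x ≠ 0 → d ≤ hwt x) {U U' : Finset (Fin v)} (hU : #U = #U')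
    (hs : #{i ∈ Icc 1 (v - #U) | Awt (dualF C) i ≠ 0} + #U ≤ d) (j : ℕ) :
    #{y ∈ words (dualF C) | Disjoint U (hsupp y) ∧ hwt y = j} =
      #{y ∈ words (dualF C) | Disjoint U' (hsupp y) ∧ hwt y = j} := by
  set J := {i ∈ Icc 1 (v - #U) | Awt (dualF C) i ≠ 0} with hJ
  let B (U : Finset (Fin v)) (j : ℕ) := #{y ∈ words (dualF C) | Disjoint U (hsupp y) ∧ hwt y = j}
  change B U j = B U' j
  have hB0 (V : Finset (Fin v)) : B V 0 = 1 := by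
    refine card_eq_one.2 ⟨0, ?_⟩
    ext y
    simp only [mem_filter, mem_words, mem_singleton, hwt_eq_zero]
    refine ⟨fun h => h.2.2, ?_⟩
    rintro rfl
    exact ⟨Submodule.zero_mem _, by simp [hsupp], rfl⟩
  have hBJ (V : Finset (Fin v)) (hV : #V = #U) (k : ℕ) (hk : k ∉ J) (hk0 : k ≠ 0) :
      B V k = 0 := by
    by_contra hne
    obtain ⟨y, hy⟩ := card_pos.1 (Nat.pos_of_ne_zero hne)
    obtain ⟨hy, hVy, hyk⟩ := mem_filter.1 hy
    have := hwt_add_card_le_of_disjoint hVy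
    refine hk (mem_filter.2 ⟨mem_Icc.2 ⟨Nat.pos_of_ne_zero hk0, by omega⟩, ?_⟩)
    rw [Awt_eq]
    exact (card_pos.2 ⟨y, mem_filter.2 ⟨hy, hyk⟩⟩).ne'
  have hsum (r : ℕ) (hr : r < #J) :
      ∑ k ∈ J, ((B U k : ℤ) - B U' k) * ((v - k : ℕ) : ℤ) ^ r = 0 := by
    have h := sum_pow_zeros_dualF_eq hC hU (r := r) (by omega)
    rw [sum_comp_hwt _ fun k => (v - k) ^ r, sum_comp_hwt _ fun k => (v - k) ^ r] at h
    simp only [filter_filter, Nat.cast_id] at h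
    have h' : ∑ k ∈ range (v + 1), ((B U k : ℤ) - B U' k) * ((v - k : ℕ) : ℤ) ^ r = 0 := by
      simp only [sub_mul, sum_sub_distrib, sub_eq_zero]
      exact_mod_cast h
    rw [← h']
    refine sum_subset (fun k hk => ?_) fun k _ hk => ?_
    · have := mem_Icc.1 (mem_filter.1 hk).1
      exact mem_range.2 (by omega)
    · rcases eq_or_ne k 0 with rfl | hk0
      · simp [hB0]
      · simp [hBJ U rfl k hk hk0, hBJ U' hU.symm k hk hk0]
  by_cases hj : j ∈ J
  · have := eq_zero_of_forall_sum_mul_pow_eq_zero (fun a ha b hb hab => ?_) hsum j hj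
    · exact_mod_cast sub_eq_zero.1 this
    · have ha := mem_Icc.1 (mem_filter.1 (mem_coe.1 ha)).1
      have hb := mem_Icc.1 (mem_filter.1 (mem_coe.1 hb)).1
      simp only [Nat.cast_inj] at hab
      omega
  · rcases eq_or_ne j 0 with rfl | hj0
    · rw [hB0, hB0]
    · rw [hBJ U rfl j hj hj0, hBJ U' hU.symm j hj hj0]

/-- If the numbers of words of given weight vanishing on `U` depend only on `#U ≤ t`, then the
numbers of words of given weight whose support contains `T` do not depend on `T` with `#T = t`. -/
lemma card_superset_eq_of_card_disjoint_eq {D : Submodule F (Fin v → F)} {t : ℕ}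
    (hD : ∀ U U' : Finset (Fin v), #U = #U' → #U ≤ t → ∀ j,
      #{y ∈ words D | Disjoint U (hsupp y) ∧ hwt y = j} =
        #{y ∈ words D | Disjoint U' (hsupp y) ∧ hwt y = j})
    {T T' : Finset (Fin v)} (hT : #T = t) (hT' : #T' = t) (j : ℕ) :
    #{y ∈ words D | T ⊆ hsupp y ∧ hwt y = j} = #{y ∈ words D | T' ⊆ hsupp y ∧ hwt y = j} := by
  have key (T : Finset (Fin v)) : (#{y ∈ words D | T ⊆ hsupp y ∧ hwt y = j} : ℤ) =
      ∑ U ∈ T.powerset,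
        (-1 : ℤ) ^ #U * #{y ∈ words D | Disjoint U (hsupp y) ∧ hwt y = j} := by
    simp only [natCast_card_filter, mul_sum]
    rw [sum_comm]
    refine sum_congr rfl fun y _ => ?_
    by_cases hy : hwt y = j
    · simpa only [hy, and_true] using (sum_powerset_neg_one_pow_disjoint (hsupp y) T).symm
    · simp [hy]
  have h := sum_powerset_eq_of_card (fun U U' h hU => by rw [h, hD U U' h hU j]) hT hT'
    (f := fun U => (-1 : ℤ) ^ #U * #{y ∈ words D | Disjoint U (hsupp y) ∧ hwt y = j})
  rw [← key, ← key] at h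
  exact_mod_cast h

/-- The MacWilliams identity for the code obtained by deleting the coordinates in `U`. -/
lemma sum_pow_card_compl_sdiff (C : Submodule F (Fin v → F)) (U : Finset (Fin v)) (a : ℚ) :
    ∑ x ∈ words C, (a + 1) ^ #(Uᶜ \ hsupp x) =
      #(words C) * ∑ y ∈ words (dualF C) with Disjoint U (hsupp y),
        (a / Fintype.card F) ^ hwt y * (a / Fintype.card F + 1) ^ (v - #U - hwt y) := by
  have hq : (Fintype.card F : ℚ) ≠ 0 := by simp
  calc
    _ = ∑ W ∈ Uᶜ.powerset, a ^ #W * #{x ∈ words C | Disjoint W (hsupp x)} := by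
      simp only [← sum_powerset_disjoint_pow, natCast_card_filter, mul_sum, mul_ite, mul_one,
        mul_zero]
      exact sum_comm
    _ = ∑ W ∈ Uᶜ.powerset, #(words C) * ((a / Fintype.card F) ^ #W *
          #{y ∈ words (dualF C) | hsupp y ⊆ W}) := by
      refine sum_congr rfl fun W _ => ?_
      have h : (#(words C) * #{y ∈ words (dualF C) | hsupp y ⊆ W} : ℚ) =
          (Fintype.card F : ℚ) ^ #W * #{x ∈ words C | Disjoint W (hsupp x)} := by
        exact_mod_cast card_words_mul_card_subset C W
      rw [mul_left_comm, h, div_pow]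
      field_simp
    _ = _ := by
      rw [← mul_sum]
      congr 1
      simp only [natCast_card_filter, mul_sum, mul_ite, mul_one, mul_zero]
      rw [sum_comm, sum_filter]
      refine sum_congr rfl fun y _ => ?_
      split_ifs with hU
      · have hsub : hsupp y ⊆ Uᶜ := by
          rwa [le_compl_iff_disjoint_left]
        rw [sum_powerset_superset_pow hsub, card_sdiff_of_subset hsub, card_compl,
          Fintype.card_fin]
        rfl
      · refine sum_eq_zero fun W hW => if_neg fun hy => hU ?_
        rw [← le_compl_iff_disjoint_left]
        exact hy.trans (mem_powerset.1 hW)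

lemma sum_pow_card_sdiff_eq {C : Submodule F (Fin v → F)} {U U' : Finset (Fin v)}
    (hU : #U = #U')
    (hD : ∀ j, #{y ∈ words (dualF C) | Disjoint U (hsupp y) ∧ hwt y = j} =
        #{y ∈ words (dualF C) | Disjoint U' (hsupp y) ∧ hwt y = j}) {w : ℚ} (hw : w ≠ 0) :
    ∑ x ∈ words C, w ^ #(hsupp x \ U) = ∑ x ∈ words C, w ^ #(hsupp x \ U') := by
  have key (V : Finset (Fin v)) : ∑ x ∈ words C, w ^ #(hsupp x \ V) =
      w ^ (v - #V) * ∑ x ∈ words C, (w⁻¹ - 1 + 1) ^ #(Vᶜ \ hsupp x) := by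
    rw [mul_sum]
    refine sum_congr rfl fun x _ => ?_
    have hcard : v - #V = #(hsupp x \ V) + #(Vᶜ \ hsupp x) := by
      have h := card_inter_add_card_sdiff Vᶜ (hsupp x)
      rw [card_compl, Fintype.card_fin, inter_comm, ← sdiff_eq_inter_compl] at h
      exact h.symm
    rw [hcard, pow_add, mul_assoc, ← mul_pow, sub_add_cancel, mul_inv_cancel₀ hw, one_pow, mul_one]
  rw [key, key, sum_pow_card_compl_sdiff, sum_pow_card_compl_sdiff, hU]
  congr 2
  rw [sum_comp_hwt _ fun k => (_ : ℚ) ^ k * (_ : ℚ) ^ (v - #U' - k),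
    sum_comp_hwt _ fun k => (_ : ℚ) ^ k * (_ : ℚ) ^ (v - #U' - k)]
  simp only [filter_filter, hD]

/-- If the numbers of dual words of given weight vanishing on `U` depend only on `#U ≤ t`, then the
numbers of words of given weight whose support contains `T` do not depend on `T` with `#T = t`. -/
lemma card_superset_eq_of_card_disjoint_dualF_eq {C : Submodule F (Fin v → F)} {t : ℕ}
    (hD : ∀ U U' : Finset (Fin v), #U = #U' → #U ≤ t → ∀ j,
      #{y ∈ words (dualF C) | Disjoint U (hsupp y) ∧ hwt y = j} =
        #{y ∈ words (dualF C) | Disjoint U' (hsupp y) ∧ hwt y = j})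
    {T T' : Finset (Fin v)} (hT : #T = t) (hT' : #T' = t) (j : ℕ) :
    #{x ∈ words C | T ⊆ hsupp x ∧ hwt x = j} = #{x ∈ words C | T' ⊆ hsupp x ∧ hwt x = j} := by
  let P (T : Finset (Fin v)) : Polynomial ℚ :=
    ∑ x ∈ words C with T ⊆ hsupp x, Polynomial.X ^ hwt x
  have hcoeff (T : Finset (Fin v)) :
      (P T).coeff j = #{x ∈ words C | T ⊆ hsupp x ∧ hwt x = j} := by
    simp only [P, Polynomial.finsetSum_coeff, Polynomial.coeff_X_pow, ← filter_filter,
      natCast_card_filter (fun x => hwt x = j), eq_comm (a := j)]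
  have heval (T : Finset (Fin v)) (hT : #T = t) (w : ℚ) :
      (w - 1) ^ t * (P T).eval w =
        w ^ t * ∑ U ∈ T.powerset, (-1) ^ #U * ∑ x ∈ words C, w ^ #(hsupp x \ U) := by
    simp only [mul_sum (words C)]
    rw [sum_comm]
    simp only [sum_powerset_neg_one_pow_mul_pow_sdiff, P, Polynomial.eval_finsetSum,
      Polynomial.eval_pow, Polynomial.eval_X, mul_sum, ← sum_filter]
    refine sum_congr rfl fun x hx => ?_
    have hTx := (mem_filter.1 hx).2
    have hcard : hwt x = t + #(hsupp x \ T) := by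
      rw [← hT, add_comm, card_sdiff_add_card_eq_card hTx]
      rfl
    rw [hcard, hT, pow_add]
    ring
  have hP : P T = P T' := by
    refine Polynomial.eq_of_infinite_eval_eq _ _ ?_
    refine ((Set.finite_singleton (0 : ℚ)).union (Set.finite_singleton 1)).infinite_compl.mono
      fun w hw => ?_
    simp only [Set.mem_compl_iff, Set.mem_union, Set.mem_singleton_iff, not_or] at hw
    refine mul_left_cancel₀ (pow_ne_zero t (sub_ne_zero.2 hw.2)) ?_
    rw [heval T hT, heval T' hT']
    congr 1
    refine sum_powerset_eq_of_card (fun U U' h hU => ?_) hT hT'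
    rw [h, sum_pow_card_sdiff_eq h (hD U U' h hU) hw.1]
  have h := hcoeff T
  rw [hP, hcoeff] at h
  exact_mod_cast h.symm

/-- Words of weight `i` with equal supports are proportional when
`i - ⌊(i + q - 2) / (q - 1)⌋` is less than the minimum distance. -/
lemma exists_smul_eq_of_hsupp_eq {C : Submodule F (Fin v → F)} {d i : ℕ}
    (hC : ∀ x ∈ C, x ≠ 0 → d ≤ hwt x)
    (hi : i - (i + Fintype.card F - 2) / (Fintype.card F - 1) < d) {x y : Fin v → F}
    (hx : x ∈ C) (hy : y ∈ C) (hwx : hwt x = i) (hi0 : i ≠ 0) (hxy : hsupp x = hsupp y) :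
    ∃ a : F, a ≠ 0 ∧ x = a • y := by
  have hq : 1 < Fintype.card F := Fintype.one_lt_card
  set m := (i + Fintype.card F - 2) / (Fintype.card F - 1) with hm
  have hmle : (Fintype.card F - 1) * m ≤ i + Fintype.card F - 2 := Nat.mul_div_le _ _
  have hm1 : 1 ≤ m := (Nat.one_le_div_iff (by omega)).2 (by omega)
  have hmul : (Fintype.card F - 1) * (m - 1) < i := by
    rw [Nat.mul_sub]
    omega
  have hcard : #(univ.erase (0 : F)) = Fintype.card F - 1 := by
    rw [card_erase_of_mem (mem_univ _), card_univ]
  obtain ⟨a, ha, hlt⟩ := exists_lt_card_fiber_of_mul_lt_card_of_maps_to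
    (s := hsupp x) (t := univ.erase (0 : F)) (f := fun k => x k / y k) (n := m - 1)
    (fun k hk => mem_erase.2 ⟨div_ne_zero (mem_hsupp.1 hk) (mem_hsupp.1 (hxy ▸ hk)), mem_univ _⟩)
    (by rw [hcard]; exact hmul.trans_eq hwx.symm)
  refine ⟨a, (mem_erase.1 ha).1, sub_eq_zero.1 ?_⟩
  by_contra hne
  have hge := hC _ (C.sub_mem hx (C.smul_mem a hy)) hne
  have hsub : hsupp (x - a • y) ⊆ hsupp x \ {k ∈ hsupp x | x k / y k = a} := by
    intro k hk
    have hk := mem_hsupp.1 hk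
    have hkx : k ∈ hsupp x := by
      by_contra hkx
      have hky := hxy ▸ hkx
      simp only [mem_hsupp, not_not] at hkx hky
      simp [hkx, hky] at hk
    refine mem_sdiff.2 ⟨hkx, fun hka => hk ?_⟩
    have hyk : y k ≠ 0 := mem_hsupp.1 (hxy ▸ hkx)
    rw [Pi.sub_apply, Pi.smul_apply, smul_eq_mul, ← (mem_filter.1 hka).2, div_mul_cancel₀ _ hyk,
      sub_self]
  have hle := card_le_card hsub
  rw [card_sdiff_of_subset (filter_subset _ _)] at hle
  change hwt (x - a • y) ≤ hwt x - _ at hle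
  omega

/-- Each support of a word of weight `i` is the support of exactly `q - 1` words. -/
lemma card_superset_eq_mul_card_supports {C : Submodule F (Fin v → F)} {d i : ℕ}
    (hC : ∀ x ∈ C, x ≠ 0 → d ≤ hwt x)
    (hi : i - (i + Fintype.card F - 2) / (Fintype.card F - 1) < d) (hi0 : i ≠ 0)
    (T : Finset (Fin v)) :
    #{x ∈ words C | T ⊆ hsupp x ∧ hwt x = i} = (Fintype.card F - 1) *
      Nat.card {S : Finset (Fin v) // (∃ x ∈ C, hwt x = i ∧ hsupp x = S) ∧ T ⊆ S} := by
  classical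
  set X := {x ∈ words C | T ⊆ hsupp x ∧ hwt x = i} with hX
  have hcard : Nat.card {S : Finset (Fin v) // (∃ x ∈ C, hwt x = i ∧ hsupp x = S) ∧ T ⊆ S} =
      #(X.image hsupp) := by
    rw [Nat.card_eq_fintype_card, Fintype.card_subtype]
    congr 1
    ext S
    simp only [hX, mem_filter, mem_univ, true_and, mem_image, mem_words]
    constructor
    · rintro ⟨⟨x, hx, hxi, rfl⟩, hT⟩
      exact ⟨x, ⟨hx, hT, hxi⟩, rfl⟩
    · rintro ⟨x, ⟨hx, hT, hxi⟩, rfl⟩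
      exact ⟨⟨x, hx, hxi, rfl⟩, hT⟩
  rw [hcard, card_eq_sum_card_fiberwise (f := hsupp) fun x hx => mem_image_of_mem hsupp hx,
    sum_const_nat (m := Fintype.card F - 1), mul_comm]
  intro S hS
  obtain ⟨y, hyX, rfl⟩ := mem_image.1 hS
  obtain ⟨hy, hTy, hyi⟩ := mem_filter.1 hyX
  rw [mem_words] at hy
  have hy0 : y ≠ 0 := fun h => hi0 (hyi.symm.trans (hwt_eq_zero.2 h))
  have hfiber : {x ∈ X | hsupp x = hsupp y} = (univ.erase (0 : F)).image (· • y) := by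
    ext x
    simp only [hX, mem_filter, mem_words, mem_image, mem_erase, mem_univ, and_true]
    constructor
    · rintro ⟨⟨hx, -, hxi⟩, hxy⟩
      obtain ⟨a, ha, rfl⟩ := exists_smul_eq_of_hsupp_eq hC hi hx hy hxi hi0 hxy
      exact ⟨a, ha, rfl⟩
    · rintro ⟨a, ha, rfl⟩
      have hsupp_smul : hsupp (a • y) = hsupp y := by
        ext k
        simp [mem_hsupp, ha]
      have hhwt : hwt (a • y) = hwt y := congrArg card hsupp_smul
      exact ⟨⟨C.smul_mem a hy, hsupp_smul ▸ hTy, hhwt.trans hyi⟩, hsupp_smul⟩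
  rw [hfiber, card_image_of_injective _ (smul_left_injective F hy0),
    card_erase_of_mem (mem_univ _), card_univ]

lemma exists_card_supports_eq {C : Submodule F (Fin v → F)} {d i t : ℕ}
    (hC : ∀ x ∈ C, x ≠ 0 → d ≤ hwt x)
    (hi : i - (i + Fintype.card F - 2) / (Fintype.card F - 1) < d) (hi0 : i ≠ 0)
    (h : ∀ T T' : Finset (Fin v), #T = t → #T' = t →
      #{x ∈ words C | T ⊆ hsupp x ∧ hwt x = i} = #{x ∈ words C | T' ⊆ hsupp x ∧ hwt x = i}) :
    ∃ lam : ℕ, ∀ T : Finset (Fin v), #T = t →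
      Nat.card {S : Finset (Fin v) // (∃ x ∈ C, hwt x = i ∧ hsupp x = S) ∧ T ⊆ S} = lam := by
  by_cases hex : ∃ T₀ : Finset (Fin v), #T₀ = t
  · obtain ⟨T₀, hT₀⟩ := hex
    refine ⟨Nat.card {S : Finset (Fin v) // (∃ x ∈ C, hwt x = i ∧ hsupp x = S) ∧ T₀ ⊆ S},
      fun T hT => ?_⟩
    have := h T T₀ hT hT₀
    rw [card_superset_eq_mul_card_supports hC hi hi0,
      card_superset_eq_mul_card_supports hC hi hi0] at this
    exact Nat.eq_of_mul_eq_mul_left (Nat.sub_pos_of_lt Fintype.one_lt_card) this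
  · exact ⟨0, fun T hT => absurd ⟨T, hT⟩ hex⟩

end Counting

lemma sub_div_pred_mono {q m n : ℕ} (hq : 2 ≤ q) (h : m ≤ n) :
    m - (m + q - 2) / (q - 1) ≤ n - (n + q - 2) / (q - 1) := by
  have hdiv : (n + q - 2) / (q - 1) ≤ (m + q - 2) / (q - 1) + (n - m) := by
    rw [← Nat.add_mul_div_left _ _ (by omega : 0 < q - 1)]
    refine Nat.div_le_div_right ?_
    have := Nat.le_mul_of_pos_left (n - m) (by omega : 0 < q - 1)
    omega
  omega

end AssmusMattson

open AssmusMattson in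
/-- **Assmus–Mattson Theorem.**  Let `C ⊆ F^v` be a linear code over the field `F` with
`q` elements, with minimum distance `d`; let `C^⊥` be its dual, with minimum distance
`d^⊥`.  Let `w` (resp. `w^⊥`) be the largest integer `≤ v` with
`w - ⌊(w+q-2)/(q-1)⌋ < d` (resp. `< d^⊥`).  Fix `0 < t < d` and let `s` be the number
of `i` with `1 ≤ i ≤ v - t` and `A_i^⊥ ≠ 0`; assume `s ≤ d - t`.  Then for each `i`
with `d ≤ i ≤ w` and `A_i ≠ 0` the distinct supports of the weight-`i` codewords of `C`
form a `t`-design, and for each `i` with `d^⊥ ≤ i ≤ min(v-t, w^⊥)` and `A_i^⊥ ≠ 0` the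
distinct supports of the weight-`i` codewords of `C^⊥` form a `t`-design. -/
theorem assmus_mattson {F : Type*} [Field F] [Fintype F] [DecidableEq F]
    (q v d dperp w wperp t s : ℕ) (hq : Fintype.card F = q)
    (C : Submodule F (Fin v → F))
    (hd : IsLeast {n : ℕ | ∃ x ∈ C, x ≠ 0 ∧ hwt x = n} d)
    (hdp : IsLeast {n : ℕ | ∃ x ∈ dualF C, x ≠ 0 ∧ hwt x = n} dperp)
    (hw : IsGreatest {n : ℕ | n ≤ v ∧ n - (n + q - 2) / (q - 1) < d} w)
    (hwp : IsGreatest {n : ℕ | n ≤ v ∧ n - (n + q - 2) / (q - 1) < dperp} wperp)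
    (ht : 0 < t) (htd : t < d)
    (hs : s = ((Finset.Icc 1 (v - t)).filter fun i => Awt (dualF C) i ≠ 0).card)
    (hsd : s ≤ d - t) :
    (∀ i, d ≤ i → i ≤ w → Awt C i ≠ 0 →
      ∃ lam : ℕ, ∀ T : Finset (Fin v), T.card = t →
        Nat.card {S : Finset (Fin v) //
          (∃ x ∈ C, hwt x = i ∧ hsupp x = S) ∧ T ⊆ S} = lam) ∧
    (∀ i, dperp ≤ i → i ≤ min (v - t) wperp → Awt (dualF C) i ≠ 0 →
      ∃ lam : ℕ, ∀ T : Finset (Fin v), T.card = t →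
        Nat.card {S : Finset (Fin v) //
          (∃ x ∈ dualF C, hwt x = i ∧ hsupp x = S) ∧ T ⊆ S} = lam) := by
  subst hq hs
  have hq : 2 ≤ Fintype.card F := Fintype.one_lt_card
  have hC : ∀ x ∈ C, x ≠ 0 → d ≤ hwt x := fun x hx h0 => hd.2 ⟨x, hx, h0, rfl⟩
  have hC' : ∀ x ∈ dualF C, x ≠ 0 → dperp ≤ hwt x := fun x hx h0 => hdp.2 ⟨x, hx, h0, rfl⟩
  have hdp0 : dperp ≠ 0 := by
    obtain ⟨x, -, hx0, hx⟩ := hdp.1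
    rw [← hx]
    exact fun h => hx0 (hwt_eq_zero.1 h)
  have hD (U U' : Finset (Fin v)) (hU : U.card = U'.card) (hUt : U.card ≤ t) :=
    card_disjoint_hwt_dualF_eq hC hU (by
      have hsub : (Finset.Icc 1 (v - U.card)).filter (fun i => Awt (dualF C) i ≠ 0) ⊆
          (Finset.Icc 1 (v - t)).filter (fun i => Awt (dualF C) i ≠ 0) ∪
            Finset.Ioc (v - t) (v - U.card) := by
        intro i
        simp only [Finset.mem_union, Finset.mem_filter, Finset.mem_Icc, Finset.mem_Ioc]
        omega
      have hle := (Finset.card_le_card hsub).trans (Finset.card_union_le _ _)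
      rw [Nat.card_Ioc] at hle
      omega)
  refine ⟨fun i hdi hiw _ => ?_, fun i hdi hiw _ => ?_⟩
  · exact exists_card_supports_eq hC ((sub_div_pred_mono hq hiw).trans_lt hw.1.2) (by omega)
      fun T T' hT hT' => card_superset_eq_of_card_disjoint_dualF_eq hD hT hT' i
  · exact exists_card_supports_eq hC'
      ((sub_div_pred_mono hq (hiw.trans (min_le_right _ _))).trans_lt hwp.1.2) (by omega)
      fun T T' hT hT' => card_superset_eq_of_card_disjoint_eq hD hT hT' i
end
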